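/- Let Λ = Z_p[[T]], γ = 1+T, and let M be a discrete Λ-module with M^∨ ≅ Λ² as Λ-modules. For each n, let M_n = M[γ^{p^n}−1] be the submodule killed by γ^{p^n}−1, and let ω_n^± ∈ Λ be the plus/minus polynomials. Then the natural inclusion M_n[ω_n^±] ⊆ M[ω_n^±] has finite cokernel; indeed both have Pontryagin dual isomorphic as Z_p-modules to (Z_p[X]/(ω_n^±))², so they have the same Z_p-corank 2·deg(ω_n^±). -/

import Mathlib

open Polynomial

noncomputable def omegaPlus (p : ℕ) [Fact p.Prime] (n : ℕ) : Polynomial ℤ_[p] :=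
  ∏ k ∈ (Finset.Icc 1 n).filter (fun k => Even k),
    (Polynomial.cyclotomic (p ^ k) ℤ_[p]).comp (Polynomial.X + 1)

noncomputable def omegaMinus (p : ℕ) [Fact p.Prime] (n : ℕ) : Polynomial ℤ_[p] :=
  ((Polynomial.X + 1) - 1) *
    ∏ k ∈ (Finset.Icc 1 n).filter (fun k => Odd k),
      (Polynomial.cyclotomic (p ^ k) ℤ_[p]).comp (Polynomial.X + 1)

/-- `ℚ_p/ℤ_p` as a `ℤ_p`-module. -/
noncomputable abbrev QZ (p : ℕ) [Fact p.Prime] : Type :=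
  ℚ_[p] ⧸ LinearMap.range (Algebra.linearMap ℤ_[p] ℚ_[p])

/-- For `ω` a polynomial (viewed in `Λ = ℤ_p[[T]]` via `X ↦ T`) and
`θ = γ^{p^n} - 1` with `γ = 1 + T`, this is the assertion that the inclusion
`M_n[ω] ⊆ M[ω]` has finite cokernel, and that both submodules have Pontryagin dual
isomorphic as `ℤ_p`-modules to `(ℤ_p[X]/(ω))²`. -/
def FiniteCokernelOfLevelInclusion (p : ℕ) [Fact p.Prime] (n : ℕ)
    (M : Type) [AddCommGroup M] [Module (PowerSeries ℤ_[p]) M]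
    [Module ℤ_[p] M] [IsScalarTower ℤ_[p] (PowerSeries ℤ_[p]) M]
    (ω : Polynomial ℤ_[p]) : Prop :=
  -- `M[ω]`, the kernel of `ω` on `M`
  let Mω : Submodule (PowerSeries ℤ_[p]) M :=
    LinearMap.ker (LinearMap.lsmul (PowerSeries ℤ_[p]) M (ω : PowerSeries ℤ_[p]))
  -- `M_n[ω] = M[γ^{p^n} - 1] ∩ M[ω]`
  let Mnω : Submodule (PowerSeries ℤ_[p]) M :=
    LinearMap.ker (LinearMap.lsmul (PowerSeries ℤ_[p]) M
      ((1 + PowerSeries.X : PowerSeries ℤ_[p]) ^ (p ^ n) - 1)) ⊓ Mω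
  -- the inclusion `M_n[ω] ⊆ M[ω]` has finite cokernel
  Finite (Mω ⧸ Submodule.comap Mω.subtype Mnω) ∧
  -- both have Pontryagin dual isomorphic as `ℤ_p`-modules to `(ℤ_p[X]/(ω))²`
  Nonempty ((Mnω →ₗ[ℤ_[p]] QZ p) ≃ₗ[ℤ_[p]]
    ((Polynomial ℤ_[p] ⧸ Ideal.span {ω}) × (Polynomial ℤ_[p] ⧸ Ideal.span {ω}))) ∧
  Nonempty ((Mω →ₗ[ℤ_[p]] QZ p) ≃ₗ[ℤ_[p]]
    ((Polynomial ℤ_[p] ⧸ Ideal.span {ω}) × (Polynomial ℤ_[p] ⧸ Ideal.span {ω})))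

namespace Module.Baer

variable {R Q M : Type*} [CommRing R] [AddCommGroup Q] [Module R Q] [AddCommGroup M] [Module R M]

/-- Over a principal ideal domain, a module on which every nonzero scalar acts surjectively
satisfies Baer's criterion. -/
theorem of_smul_surjective [IsDomain R] [IsPrincipalIdealRing R]
    (h : ∀ r : R, r ≠ 0 → ∀ q : Q, ∃ q' : Q, r • q' = q) : Module.Baer R Q := by
  intro I g
  obtain ⟨r, rfl⟩ := (inferInstance : I.IsPrincipal).principal
  by_cases hr : r = 0
  · refine ⟨0, fun x hx ↦ ?_⟩
    have hx0 : x = 0 := by simpa [hr] using hx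
    subst hx0
    exact (map_zero g).symm
  · obtain ⟨q, hq⟩ := h r hr (g ⟨r, Submodule.mem_span_singleton_self r⟩)
    refine ⟨LinearMap.toSpanSingleton R Q q, fun x hx ↦ ?_⟩
    obtain ⟨c, rfl⟩ := Submodule.mem_span_singleton.mp hx
    rw [LinearMap.toSpanSingleton_apply, smul_assoc, hq, ← map_smul]
    rfl

/-- A map into a Baer module factors through an endomorphism as soon as it vanishes on its
kernel. -/
theorem exists_comp_eq_of_ker_le (hQ : Module.Baer R Q) (φ : M →ₗ[R] M) (f : M →ₗ[R] Q)
    (hf : LinearMap.ker φ ≤ LinearMap.ker f) : ∃ g : M →ₗ[R] Q, g ∘ₗ φ = f := by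
  obtain ⟨g, hg⟩ := hQ.extension_property ((LinearMap.ker φ).liftQ φ le_rfl)
    (LinearMap.ker_eq_bot.mp (Submodule.ker_liftQ_eq_bot _ _ _ le_rfl))
    ((LinearMap.ker φ).liftQ f hf)
  exact ⟨g, LinearMap.ext fun m ↦ LinearMap.congr_fun hg (Submodule.Quotient.mk m)⟩

end Module.Baer

/-- If the dual of `M` is free of rank two over `S`, then the dual of the `a`-torsion of `M` is
free of rank two over `S / a`. -/
theorem nonempty_dual_torsion_equiv {R S Q M : Type*} [CommRing R] [CommRing S] [Algebra R S]
    [AddCommGroup Q] [Module R Q] [AddCommGroup M] [Module S M] [Module R M] [IsScalarTower R S M]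
    (hQ : Module.Baer R Q) (e : (M →ₗ[R] Q) ≃ₗ[R] (S × S))
    (he : ∀ (x : S) (f : M →ₗ[R] Q),
      e (f ∘ₗ (LinearMap.lsmul S M x).restrictScalars R) = x • e f) (a : S) :
    Nonempty ((LinearMap.ker (LinearMap.lsmul S M a) →ₗ[R] Q) ≃ₗ[R]
      ((S ⧸ Ideal.span {a}) × (S ⧸ Ideal.span {a}))) := by
  let N := LinearMap.ker (LinearMap.lsmul S M a)
  let i : N →ₗ[R] M := N.subtype.restrictScalars R
  let res : (M →ₗ[R] Q) →ₗ[R] (N →ₗ[R] Q) := LinearMap.lcomp R Q i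
  let mk : S →ₗ[R] S ⧸ Ideal.span {a} := (Ideal.Quotient.mkₐ R (Ideal.span {a})).toLinearMap
  let π : (M →ₗ[R] Q) →ₗ[R] ((S ⧸ Ideal.span {a}) × (S ⧸ Ideal.span {a})) :=
    mk.prodMap mk ∘ₗ e.toLinearMap
  have hmk : Function.Surjective mk := Ideal.Quotient.mk_surjective
  have hres : Function.Surjective res := fun f ↦
    hQ.extension_property i Subtype.val_injective f
  have hπ : Function.Surjective π := (hmk.prodMap hmk).comp e.surjective
  have hker : LinearMap.ker res = LinearMap.ker π := by
    ext f
    constructor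
    · intro hf
      obtain ⟨g, rfl⟩ := hQ.exists_comp_eq_of_ker_le
        ((LinearMap.lsmul S M a).restrictScalars R) f
        (fun m hm ↦ LinearMap.congr_fun (LinearMap.mem_ker.mp hf) ⟨m, hm⟩)
      refine LinearMap.mem_ker.mpr (Prod.ext ?_ ?_) <;>
      · simp only [π, LinearMap.comp_apply, LinearEquiv.coe_coe, he]
        exact Ideal.Quotient.eq_zero_iff_mem.mpr
          (Ideal.mul_mem_right _ _ (Ideal.mem_span_singleton_self a))
    · intro hf
      have h := LinearMap.mem_ker.mp hf
      obtain ⟨y, hy⟩ := Ideal.mem_span_singleton.mp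
        (Ideal.Quotient.eq_zero_iff_mem.mp (congrArg Prod.fst h))
      obtain ⟨z, hz⟩ := Ideal.mem_span_singleton.mp
        (Ideal.Quotient.eq_zero_iff_mem.mp (congrArg Prod.snd h))
      have hf' : f = e.symm (y, z) ∘ₗ (LinearMap.lsmul S M a).restrictScalars R := by
        apply e.injective
        rw [he, e.apply_symm_apply]
        exact Prod.ext hy hz
      refine LinearMap.mem_ker.mpr (LinearMap.ext fun m ↦ ?_)
      have hm : a • (m : M) = 0 := m.2
      rw [hf']
      change e.symm (y, z) (a • (m : M)) = 0
      rw [hm, map_zero]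
  exact ⟨(res.quotKerEquivOfSurjective hres).symm ≪≫ₗ Submodule.quotEquivOfEq _ _ hker ≪≫ₗ
    π.quotKerEquivOfSurjective hπ⟩

section

variable (p : ℕ) [Fact p.Prime]

theorem baer_QZ : Module.Baer ℤ_[p] (QZ p) := by
  refine Module.Baer.of_smul_surjective fun r hr q ↦ ?_
  obtain ⟨x, rfl⟩ := Submodule.Quotient.mk_surjective _ q
  have hr' : (r : ℚ_[p]) ≠ 0 := by simpa using hr
  refine ⟨Submodule.Quotient.mk ((r : ℚ_[p])⁻¹ * x), ?_⟩
  rw [← Submodule.Quotient.mk_smul]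
  congr 1
  rw [Algebra.smul_def]
  exact mul_inv_cancel_left₀ hr' x

theorem isDistinguishedAt_cyclotomic_comp {k : ℕ} (hk : k ≠ 0) :
    ((cyclotomic (p ^ k) ℤ_[p]).comp (X + 1)).IsDistinguishedAt
      (IsLocalRing.maximalIdeal ℤ_[p]) := by
  obtain ⟨k, rfl⟩ := Nat.exists_eq_succ_of_ne_zero hk
  have h := (cyclotomic_prime_pow_comp_X_add_one_isEisensteinAt p k).isWeaklyEisensteinAt.map
    (Int.castRingHom ℤ_[p])
  have hI : (Ideal.span {(p : ℤ)}).map (Int.castRingHom ℤ_[p]) =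
      IsLocalRing.maximalIdeal ℤ_[p] := by
    rw [PadicInt.maximalIdeal_eq_span_p]
    exact (Ideal.map_span _ _).trans (by simp)
  rw [Ideal.submodule_span_eq, hI, map_comp, map_cyclotomic] at h
  refine ⟨by simpa using h, ?_⟩
  simpa using (cyclotomic.monic (p ^ (k + 1)) ℤ_[p]).comp_X_add_C 1

theorem isDistinguishedAt_prod {R ι : Type*} [CommRing R] {I : Ideal R} (s : Finset ι)
    (f : ι → R[X]) (h : ∀ k ∈ s, (f k).IsDistinguishedAt I) :
    (∏ k ∈ s, f k).IsDistinguishedAt I := by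
  refine Finset.prod_induction f (fun g ↦ g.IsDistinguishedAt I) (fun _ _ ↦ .mul) ?_ h
  exact ⟨⟨fun hn ↦ by simp at hn⟩, monic_one⟩

theorem isDistinguishedAt_X {R : Type*} [CommRing R] [Nontrivial R] (I : Ideal R) :
    (X : R[X]).IsDistinguishedAt I := by
  refine ⟨⟨fun {n} hn ↦ ?_⟩, monic_X⟩
  obtain rfl : n = 0 := by simpa using hn
  simp

theorem isDistinguishedAt_omegaPlus (n : ℕ) :
    (omegaPlus p n).IsDistinguishedAt (IsLocalRing.maximalIdeal ℤ_[p]) :=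
  isDistinguishedAt_prod _ _ fun k hk ↦ isDistinguishedAt_cyclotomic_comp p (by
    simp only [Finset.mem_filter, Finset.mem_Icc] at hk
    lia)

theorem isDistinguishedAt_omegaMinus (n : ℕ) :
    (omegaMinus p n).IsDistinguishedAt (IsLocalRing.maximalIdeal ℤ_[p]) := by
  refine .mul ?_ (isDistinguishedAt_prod _ _ fun k hk ↦ isDistinguishedAt_cyclotomic_comp p (by
    simp only [Finset.mem_filter, Finset.mem_Icc] at hk
    lia))
  simpa using isDistinguishedAt_X _

theorem prod_cyclotomic_prime_pow_comp (n : ℕ) :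
    ∏ k ∈ Finset.range (n + 1), (cyclotomic (p ^ k) ℤ_[p]).comp (X + 1) =
      (X + 1) ^ p ^ n - 1 := by
  have hp : p.Prime := Fact.out
  have h := prod_cyclotomic_eq_X_pow_sub_one (pow_pos hp.pos n) ℤ_[p]
  rw [Nat.divisors_prime_pow hp, Finset.prod_map] at h
  rw [← prod_comp]
  simpa using congrArg (fun f : ℤ_[p][X] ↦ f.comp (X + 1)) h

theorem omegaPlus_dvd (n : ℕ) : omegaPlus p n ∣ (X + 1) ^ p ^ n - 1 := by
  rw [← prod_cyclotomic_prime_pow_comp]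
  refine Finset.prod_dvd_prod_of_subset _ _ _ fun k hk ↦ ?_
  simp only [Finset.mem_filter, Finset.mem_Icc, Finset.mem_range] at hk ⊢
  lia

theorem omegaMinus_dvd (n : ℕ) : omegaMinus p n ∣ (X + 1) ^ p ^ n - 1 := by
  rw [← prod_cyclotomic_prime_pow_comp, Finset.prod_range_eq_mul_Ico _ n.succ_pos, omegaMinus]
  refine mul_dvd_mul (by simp) (Finset.prod_dvd_prod_of_subset _ _ _ fun k hk ↦ ?_)
  simp only [Finset.mem_filter, Finset.mem_Icc, Finset.mem_Ico] at hk ⊢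
  lia

end

theorem finiteCokernelOfLevelInclusion_of_dvd (p : ℕ) [Fact p.Prime] (n : ℕ)
    (M : Type) [AddCommGroup M] [Module (PowerSeries ℤ_[p]) M]
    [Module ℤ_[p] M] [IsScalarTower ℤ_[p] (PowerSeries ℤ_[p]) M]
    (e : (M →ₗ[ℤ_[p]] QZ p) ≃ₗ[ℤ_[p]] (PowerSeries ℤ_[p] × PowerSeries ℤ_[p]))
    (he : ∀ (x : PowerSeries ℤ_[p]) (f : M →ₗ[ℤ_[p]] QZ p),
      e (f ∘ₗ ((LinearMap.lsmul (PowerSeries ℤ_[p]) M x).restrictScalars ℤ_[p])) = x • e f)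
    {ω : ℤ_[p][X]} (hω : ω.IsDistinguishedAt (IsLocalRing.maximalIdeal ℤ_[p]))
    (hdvd : ω ∣ (X + 1) ^ p ^ n - 1) :
    FiniteCokernelOfLevelInclusion p n M ω := by
  obtain ⟨c, hc⟩ := hdvd
  have hθ : (1 + PowerSeries.X : PowerSeries ℤ_[p]) ^ p ^ n - 1 = c * ω := by
    have h := congrArg (fun f : ℤ_[p][X] ↦ (f : PowerSeries ℤ_[p])) hc
    simp only [coe_sub, coe_pow, coe_add, coe_X, coe_one, coe_mul] at h
    rw [add_comm, h, mul_comm]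
  have hle : LinearMap.ker (LinearMap.lsmul (PowerSeries ℤ_[p]) M (ω : PowerSeries ℤ_[p])) ≤
      LinearMap.ker (LinearMap.lsmul (PowerSeries ℤ_[p]) M
        ((1 + PowerSeries.X : PowerSeries ℤ_[p]) ^ (p ^ n) - 1)) := by
    intro m hm
    have hm' : (ω : PowerSeries ℤ_[p]) • m = 0 := hm
    rw [LinearMap.mem_ker, LinearMap.lsmul_apply, hθ, mul_smul, hm', smul_zero]
  let ε := hω.algEquivQuotient.toLinearEquiv
  obtain ⟨d⟩ := nonempty_dual_torsion_equiv (baer_QZ p) e he (ω : PowerSeries ℤ_[p])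
  let δ := d ≪≫ₗ (ε.prodCongr ε).symm
  dsimp only [FiniteCokernelOfLevelInclusion]
  rw [inf_eq_right.mpr hle]
  refine ⟨?_, ⟨δ⟩, ⟨δ⟩⟩
  rw [Submodule.comap_subtype_self]
  infer_instance

/-- if `M` is a discrete `Λ`-module with `M^∨ ≅ Λ²` as `Λ`-modules, then
for each `n` the inclusion `M_n[ω_n^±] ⊆ M[ω_n^±]` has finite cokernel; indeed both
have Pontryagin dual isomorphic as `ℤ_p`-modules to `(ℤ_p[X]/(ω_n^±))²`. -/
theorem level_torsion_inclusion_finite_cokernel (p : ℕ) [Fact p.Prime] (n : ℕ)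
    (M : Type) [AddCommGroup M] [Module (PowerSeries ℤ_[p]) M]
    [Module ℤ_[p] M] [IsScalarTower ℤ_[p] (PowerSeries ℤ_[p]) M]
    -- `M^∨ ≅ Λ²` as `Λ`-modules
    (hdual : ∃ e : (M →ₗ[ℤ_[p]] QZ p) ≃ₗ[ℤ_[p]]
        (PowerSeries ℤ_[p] × PowerSeries ℤ_[p]),
      ∀ (x : PowerSeries ℤ_[p]) (f : M →ₗ[ℤ_[p]] QZ p),
        e (f ∘ₗ ((LinearMap.lsmul (PowerSeries ℤ_[p]) M x).restrictScalars ℤ_[p])) =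
          x • e f) :
    FiniteCokernelOfLevelInclusion p n M (omegaPlus p n) ∧
    FiniteCokernelOfLevelInclusion p n M (omegaMinus p n) := by
  obtain ⟨e, he⟩ := hdual
  exact ⟨finiteCokernelOfLevelInclusion_of_dvd p n M e he (isDistinguishedAt_omegaPlus p n)
      (omegaPlus_dvd p n),
    finiteCokernelOfLevelInclusion_of_dvd p n M e he (isDistinguishedAt_omegaMinus p n)
      (omegaMinus_dvd p n)⟩
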